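/- Let (A_S,S) be an Artin-Tits system of spherical type, s,t ∈ S, g ∈ A_S, and let g = g₁g₂⁻¹ be the right normal form of g (g₁,g₂ ∈ A_S⁺ with trivial right gcd). Then gt = sg if and only if there exists u ∈ S such that tg₂ = g₂u and sg₁ = g₁u. -/

import Mathlib

/-!
Common definitions for formalizing "Normalisateur des sous-groupes paraboliques
des groupes d'Artin-Tits" (E. Godelle).

We fix a Coxeter matrix `M` over a finite index set `B` (Mathlib's convention:
`M s t = 0` encodes `m_{s,t} = ∞`).  The Artin-Tits group `Artin M` is the
presented group on the braid relations, the Coxeter group is Mathlib's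
`M.Group`, and `proj : Artin M →* M.Group` is the canonical projection
(adding the relations `s² = 1`).
-/

namespace ArtinTitsPaper

open List

variable {B : Type*}

/-- The alternating list `[s, t, s, t, ...]` with `n` terms, starting with `s`. -/
def altList (s t : B) : ℕ → List B
  | 0 => []
  | n + 1 => s :: altList t s n

/-- The braid relators `(sts⋯)(tst⋯)⁻¹` (`m_{s,t}` letters each) for `s ≠ t`,
`m_{s,t} ≠ ∞`. -/
def braidRels (M : CoxeterMatrix B) : Set (FreeGroup B) :=
  { r | ∃ s t : B, s ≠ t ∧ M s t ≠ 0 ∧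
      r = ((altList s t (M s t)).map FreeGroup.of).prod *
          (((altList t s (M s t)).map FreeGroup.of).prod)⁻¹ }

/-- The Artin-Tits group associated to the Coxeter matrix `M`. -/
def Artin (M : CoxeterMatrix B) : Type _ := PresentedGroup (braidRels M)

instance (M : CoxeterMatrix B) : Group (Artin M) :=
  QuotientGroup.Quotient.group _

/-- The standard generator of `Artin M` indexed by `s : B` (the image of `S` in `A_S`). -/
def gen (M : CoxeterMatrix B) (s : B) : Artin M := PresentedGroup.of s

theorem altList_eq_reverse_alternatingWord (s t : B) (n : ℕ) :
    altList s t n = (CoxeterSystem.alternatingWord t s n).reverse := by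
  induction n generalizing s t with
  | zero => rfl
  | succ n ih =>
      rw [altList, CoxeterSystem.alternatingWord_succ, List.concat_eq_append,
        List.reverse_append]
      simp [ih]

theorem lift_simple_listProd (M : CoxeterMatrix B) (l : List B) :
    FreeGroup.lift M.simple ((l.map FreeGroup.of).prod) =
      M.toCoxeterSystem.wordProd l := by
  rw [CoxeterSystem.wordProd, map_list_prod, List.map_map]
  simp [Function.comp_def, CoxeterMatrix.toCoxeterSystem_simple]

theorem braid_lift (M : CoxeterMatrix B) :
    ∀ r ∈ braidRels M, FreeGroup.lift M.simple r = 1 := by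
  rintro r ⟨s, t, hst, hm, rfl⟩
  rw [map_mul, map_inv, lift_simple_listProd, lift_simple_listProd,
    altList_eq_reverse_alternatingWord, altList_eq_reverse_alternatingWord,
    CoxeterSystem.wordProd_reverse, CoxeterSystem.wordProd_reverse]
  have hsym : M s t = M t s := M.symmetric s t
  have hb := M.toCoxeterSystem.wordProd_braidWord_eq t s
  rw [CoxeterSystem.braidWord, CoxeterSystem.braidWord, ← hsym] at hb
  rw [hb]
  simp

/-- The canonical projection from the Artin-Tits group onto the Coxeter group
(adding the relations `s² = 1`). -/
def proj (M : CoxeterMatrix B) : Artin M →* M.Group :=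
  PresentedGroup.toGroup (braid_lift M)

/-- The positive monoid `A_S⁺`, the submonoid of `A_S` generated by `S`. -/
def posMon (M : CoxeterMatrix B) : Submonoid (Artin M) :=
  Submonoid.closure (Set.range (gen M))

/-- The submonoid `A_X⁺` of `A_S` generated by `X ⊆ S`. -/
def posMonOn (M : CoxeterMatrix B) (X : Set B) : Submonoid (Artin M) :=
  Submonoid.closure (gen M '' X)

/-- The standard parabolic subgroup `A_X` of `A_S` generated by `X ⊆ S`. -/
def stdSub (M : CoxeterMatrix B) (X : Set B) : Subgroup (Artin M) :=
  Subgroup.closure (gen M '' X)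

/-- The standard parabolic subgroup `W_X` of the Coxeter group `W_S`. -/
def coxSub (M : CoxeterMatrix B) (X : Set B) : Subgroup M.Group :=
  Subgroup.closure (M.simple '' X)

/-- `X ⊆ S` is of spherical type if the Coxeter group `W_X` is finite. -/
def IsSpherical (M : CoxeterMatrix B) (X : Set B) : Prop :=
  Finite (coxSub M X)

/-- `a` left-divides `b` in the positive monoid: `b = a c` with `c ∈ A_S⁺`. -/
def ldvd (M : CoxeterMatrix B) (a b : Artin M) : Prop :=
  ∃ c ∈ posMon M, a * c = b

/-- `a` right-divides `b` in the positive monoid: `b = c a` with `c ∈ A_S⁺`. -/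
def rdvd (M : CoxeterMatrix B) (a b : Artin M) : Prop :=
  ∃ c ∈ posMon M, c * a = b

/-- `d` is the least common multiple `Δ_X` of `X` in `A_X⁺` (for left-divisibility). -/
def IsDelta (M : CoxeterMatrix B) (X : Set B) (d : Artin M) : Prop :=
  d ∈ posMonOn M X ∧
  (∀ s ∈ X, ∃ c ∈ posMonOn M X, gen M s * c = d) ∧
  ∀ m ∈ posMonOn M X, (∀ s ∈ X, ∃ c ∈ posMonOn M X, gen M s * c = m) →
    ∃ c ∈ posMonOn M X, d * c = m

/-- The subset `Xg = {σ_x g : x ∈ X}` of `A_S`. -/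
def leftMul (M : CoxeterMatrix B) (X : Set B) (g : Artin M) : Set (Artin M) :=
  (fun x => gen M x * g) '' X

/-- The subset `gX = {g σ_x : x ∈ X}` of `A_S`. -/
def rightMul (M : CoxeterMatrix B) (X : Set B) (g : Artin M) : Set (Artin M) :=
  (fun x => g * gen M x) '' X

/-- `Conj(S;X,Y) = {g ∈ A_S : gX = Yg}`. -/
def conjSet (M : CoxeterMatrix B) (X Y : Set B) : Set (Artin M) :=
  { g | rightMul M X g = leftMul M Y g }

/-- `Conj⁺(S;X,Y) = {g ∈ A_S⁺ : gX = Yg}`. -/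
def conjPos (M : CoxeterMatrix B) (X Y : Set B) : Set (Artin M) :=
  { g | g ∈ posMon M ∧ rightMul M X g = leftMul M Y g }

/-- The quasi-centralizer `QZ_{A_S}(A_X) = {g ∈ A_S : gX = Xg}`. -/
def QZset (M : CoxeterMatrix B) (X : Set B) : Set (Artin M) :=
  conjSet M X X

/-- The indecomposable component of `Z` containing `t` (vertices of `Z` joined to `t`
by a path of edges `m_{a,b} ≠ 2` in the Coxeter diagram on `Z`). -/
def comp (M : CoxeterMatrix B) (Z : Set B) (t : B) : Set B :=
  { s ∈ Z | Relation.ReflTransGen (fun a b => a ∈ Z ∧ b ∈ Z ∧ a ≠ b ∧ M a b ≠ 2) t s }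

/-- `Z` is indecomposable: it admits no nontrivial partition `Z = Z₁ ∪ Z₂` with
`m_{a,b} = 2` for `a ∈ Z₁`, `b ∈ Z₂`. -/
def Indecomp (M : CoxeterMatrix B) (Z : Set B) : Prop :=
  ¬ ∃ Z₁ Z₂ : Set B, Z₁.Nonempty ∧ Z₂.Nonempty ∧ Z₁ ∪ Z₂ = Z ∧ Disjoint Z₁ Z₂ ∧
      ∀ a ∈ Z₁, ∀ b ∈ Z₂, M a b = 2

/-- `g` is an elementary positive `Y`-ribbon-`X`: `g = d_{X,t}` for some `t ∈ S` with
`X(t)` of spherical type, where `d_{X,t} = Δ_{X(t)}` if `t ∈ X` and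
`d_{X,t} = Δ_{X(t)} Δ_{X(t)∖{t}}⁻¹` otherwise, and `Y ⊆ X ∪ {t}` satisfies `Yg = gX`. -/
def IsElemRibbon (M : CoxeterMatrix B) (X Y : Set B) (g : Artin M) : Prop :=
  ∃ t : B, IsSpherical M (comp M (X ∪ {t}) t) ∧
    ((t ∈ X ∧ IsDelta M (comp M (X ∪ {t}) t) g) ∨
      (t ∉ X ∧ ∃ d₁ d₂ : Artin M, IsDelta M (comp M (X ∪ {t}) t) d₁ ∧
        IsDelta M ((comp M (X ∪ {t}) t) \ {t}) d₂ ∧ g = d₁ * d₂⁻¹)) ∧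
    Y ⊆ X ∪ {t} ∧ leftMul M Y g = rightMul M X g

/-- `g` is a positive `Y`-ribbon-`X`: a product `g = g_n ⋯ g_1` of elementary positive
`X_i`-ribbons-`X_{i-1}` with `X_0 = X`, `X_n = Y`. -/
inductive IsRibbon (M : CoxeterMatrix B) : Set B → Set B → Artin M → Prop
  | nil (X : Set B) : IsRibbon M X X 1
  | cons {X Y Z : Set B} {g h : Artin M} :
      IsRibbon M X Y g → IsElemRibbon M Y Z h → IsRibbon M X Z (h * g)

/-- `g` is `X`-reduced: no element of `X` left-divides `g`. -/
def lreduced (M : CoxeterMatrix B) (X : Set B) (g : Artin M) : Prop :=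
  ∀ s ∈ X, ¬ ldvd M (gen M s) g

/-- `g` is reduced-`X`: no element of `X` right-divides `g`. -/
def rreduced (M : CoxeterMatrix B) (X : Set B) (g : Artin M) : Prop :=
  ∀ s ∈ X, ¬ rdvd M (gen M s) g

/-- The set `H_X` of elements `g₁ g₂⁻¹` where `g₁, g₂` are `X`-reduced positive
`X`-ribbons-`X`. -/
def HXset (M : CoxeterMatrix B) (X : Set B) : Set (Artin M) :=
  { g | ∃ g₁ g₂ : Artin M, IsRibbon M X X g₁ ∧ lreduced M X g₁ ∧
      IsRibbon M X X g₂ ∧ lreduced M X g₂ ∧ g = g₁ * g₂⁻¹ }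

/-- The length of a positive element (the common length of its expressions as words
in the generators; junk value `0` outside of `A_S⁺`). -/
noncomputable def len (M : CoxeterMatrix B) (g : Artin M) : ℕ :=
  sInf { n | ∃ l : List B, l.length = n ∧ (l.map (gen M)).prod = g }

/-- The length of an element of the Coxeter group `W_S`. -/
noncomputable def wlen (M : CoxeterMatrix B) (w : M.Group) : ℕ :=
  sInf { n | ∃ l : List B, l.length = n ∧ (l.map M.simple).prod = w }

/-- `g ∈ A_{S,red}`: `g` is positive and has the same length as its image in `W_S`. -/
def Red (M : CoxeterMatrix B) (g : Artin M) : Prop :=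
  g ∈ posMon M ∧ len M g = wlen M (proj M g)

/-- `C` is a simple `s`-chain-`u`: either `C = 1` and `s = u`, or
`C = tst⋯` (`k` letters, `k < m_{s,t}`) with `u ∈ {s,t}` and `C·u = tst⋯` (`k+1` letters). -/
def IsSimpleChain (M : CoxeterMatrix B) (s u : B) (C : Artin M) : Prop :=
  (C = 1 ∧ s = u) ∨
  ∃ t : B, t ≠ s ∧ (u = s ∨ u = t) ∧ ∃ k : ℕ,
    (M s t = 0 ∨ k < M s t) ∧
    C = ((altList t s k).map (gen M)).prod ∧
    C * gen M u = ((altList t s (k + 1)).map (gen M)).prod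

/-- `C` is an `s`-chain-`t`: a product `C₁ ⋯ C_k` of simple chains composing from
origin `s` to target `t`. -/
inductive IsChain (M : CoxeterMatrix B) : B → B → Artin M → Prop
  | single {s u : B} {C : Artin M} : IsSimpleChain M s u C → IsChain M s u C
  | comp {s u v : B} {C D : Artin M} :
      IsChain M s u C → IsSimpleChain M u v D → IsChain M s v (C * D)

section AlternatingLists

@[simp] theorem length_altList (s t : B) (k : ℕ) : (altList s t k).length = k := by
  induction k generalizing s t with
  | zero => rfl
  | succ k ih => simp [altList, ih]

/-- The letter that follows `altList s t k` in the alternating sequence `s, t, s, …`. -/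
def altNext (s t : B) (k : ℕ) : B := if Even k then s else t

theorem altNext_succ (s t : B) (k : ℕ) : altNext s t (k + 1) = altNext t s k := by
  by_cases h : Even k <;> simp [altNext, Nat.even_add_one, h]

theorem altList_succ' (s t : B) (k : ℕ) :
    altList s t (k + 1) = altList s t k ++ [altNext s t k] := by
  induction k generalizing s t with
  | zero => simp [altList, altNext]
  | succ k ih =>
    rw [altList, ih t s, altNext_succ]
    rfl

theorem reverse_altList (s t : B) (k : ℕ) :
    (altList s t k).reverse = altList (altNext t s k) (altNext s t k) k := by
  induction k with
  | zero => rfl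
  | succ k ih =>
    rw [altList_succ', List.reverse_append, ih, altNext_succ, altNext_succ]
    rfl

theorem altNext_eq_or (s t : B) (k : ℕ) :
    (altNext s t k = s ∧ altNext t s k = t) ∨ (altNext s t k = t ∧ altNext t s k = s) := by
  by_cases h : Even k <;> simp [altNext, h]

end AlternatingLists

section GeometricRepresentation

open Real

variable (M : CoxeterMatrix B)

/-- The linear form `v ↦ 2 ⟨α_s, v⟩` attached to a simple root of the Tits bilinear form. -/
noncomputable def simpleCoroot (s : B) : (B →₀ ℝ) →ₗ[ℝ] ℝ :=
  Finsupp.linearCombination ℝ fun t => -(2 * cos (π / M s t))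

/-- The simple root `α_s`. -/
noncomputable def simpleRoot (s : B) : B →₀ ℝ := Finsupp.single s 1

theorem simpleCoroot_simpleRoot (s t : B) :
    simpleCoroot M s (simpleRoot t) = -(2 * cos (π / M s t)) := by
  simp [simpleCoroot, simpleRoot]

theorem simpleCoroot_simpleRoot_self (s : B) : simpleCoroot M s (simpleRoot s) = 2 := by
  simp [simpleCoroot_simpleRoot]

/-- The reflection `σ_s` of the geometric representation. -/
noncomputable def rootReflection (s : B) : (B →₀ ℝ) ≃ₗ[ℝ] (B →₀ ℝ) :=
  Module.reflection (simpleCoroot_simpleRoot_self M s)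

theorem rootReflection_apply (s : B) (v : B →₀ ℝ) :
    rootReflection M s v = v - simpleCoroot M s v • simpleRoot s :=
  Module.reflection_apply _ _

theorem rootReflection_mul_self (s : B) : rootReflection M s * rootReflection M s = 1 := by
  ext1 v
  exact Module.involutive_reflection (simpleCoroot_simpleRoot_self M s) v

open Polynomial.Chebyshev in
theorem rootReflection_mul_pow (s t : B) :
    (rootReflection M s * rootReflection M t) ^ M s t = 1 := by
  rcases eq_or_ne s t with rfl | hst
  · rw [rootReflection_mul_self, one_pow]
  obtain hm0 | hm0 := eq_or_ne (M s t) 0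
  · rw [hm0, pow_zero]
  have hm1 : M s t ≠ 1 := M.off_diagonal s t hst
  have hsym : M t s = M s t := M.symmetric t s
  have hx : simpleCoroot M s (simpleRoot t) = -(2 * cos (π / M s t)) :=
    simpleCoroot_simpleRoot M s t
  have hy : simpleCoroot M t (simpleRoot s) = -(2 * cos (π / M s t)) := by
    rw [simpleCoroot_simpleRoot, hsym]
  ext1 v
  rw [rootReflection, rootReflection, Module.reflection_mul_reflection_pow_apply _ _ (M s t) v
    (2 * cos (2 * (π / M s t))) (by rw [hx, hy, cos_two_mul]; ring), hx, hy]
  generalize hm : M s t = m at *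
  rw [LinearEquiv.coe_one, id_eq]
  obtain hm2 | hm2 := eq_or_ne m 2
  · subst hm2
    have h1 : cos (2 * (π / (2 : ℕ))) = -1 := by
      rw [show 2 * (π / ((2 : ℕ) : ℝ)) = π by push_cast; ring, cos_pi]
    have h2 : cos (π / (2 : ℕ)) = 0 := by push_cast; exact cos_pi_div_two
    simp only [h1, h2]
    norm_num [S_zero, S_one, S_neg_one]
    module
  have hm3 : 3 ≤ m := by omega
  have hmR : (3 : ℝ) ≤ m := by exact_mod_cast hm3
  have hmpos : (0 : ℝ) < m := by linarith
  have hφ : 0 < sin (2 * (π / m)) := by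
    apply sin_pos_of_pos_of_lt_pi
    · have := pi_pos; positivity
    · rw [← mul_div_assoc, div_lt_iff₀ hmpos]
      nlinarith [pi_pos]
  have hS (n : ℤ) := S_two_mul_real_cos (2 * (π / m)) n
  have hcoef1 : ((S ℝ (((m : ℤ) - 2) / 2)).eval (2 * cos (2 * (π / m))) *
      ((S ℝ (((m : ℤ) - 1) / 2)).eval (2 * cos (2 * (π / m))) +
        (S ℝ (((m : ℤ) - 3) / 2)).eval (2 * cos (2 * (π / m))))) = 0 ∧
      ((S ℝ (((m : ℤ) - 1) / 2)).eval (2 * cos (2 * (π / m))) *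
      ((S ℝ ((m : ℤ) / 2)).eval (2 * cos (2 * (π / m))) +
        (S ℝ (((m : ℤ) - 2) / 2)).eval (2 * cos (2 * (π / m))))) = 0 := by
    obtain ⟨k, rfl | rfl⟩ := Nat.even_or_odd' m
    · have e1 : (((2 * k : ℕ) : ℤ) - 2) / 2 = k - 1 := by omega
      have e2 : (((2 * k : ℕ) : ℤ) - 1) / 2 = k - 1 := by omega
      rw [e1, e2]
      have : (S ℝ ((k : ℤ) - 1)).eval (2 * cos (2 * (π / (2 * k : ℕ)))) = 0 := by
        have h := hS (k - 1)
        have hk : (((k : ℤ) - 1 : ℤ) + 1 : ℝ) * (2 * (π / (2 * k : ℕ))) = π := by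
          have hk0 : (k : ℝ) ≠ 0 := by
            push_cast at hmpos
            intro h
            simp [h] at hmpos
          push_cast
          field_simp
          ring
        rw [hk, sin_pi] at h
        exact (mul_eq_zero.mp h).resolve_right hφ.ne'
      rw [this]
      simp only [zero_mul, and_self]
    · have e1 : (((2 * k + 1 : ℕ) : ℤ) - 2) / 2 = k - 1 := by omega
      have e2 : (((2 * k + 1 : ℕ) : ℤ) - 1) / 2 = k := by omega
      have e3 : (((2 * k + 1 : ℕ) : ℤ) - 3) / 2 = k - 1 := by omega
      have e4 : (((2 * k + 1 : ℕ) : ℤ)) / 2 = k := by omega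
      rw [e1, e2, e3, e4]
      have : (S ℝ (k : ℤ)).eval (2 * cos (2 * (π / (2 * k + 1 : ℕ)))) +
          (S ℝ ((k : ℤ) - 1)).eval (2 * cos (2 * (π / (2 * k + 1 : ℕ)))) = 0 := by
        have h := hS k
        have h' := hS (k - 1)
        have hk : (((k : ℤ) - 1 : ℤ) + 1 : ℝ) * (2 * (π / (2 * k + 1 : ℕ))) =
            2 * π - ((k : ℤ) + 1 : ℝ) * (2 * (π / (2 * k + 1 : ℕ))) := by
          push_cast at hmpos ⊢
          field_simp
          ring
        rw [hk, sin_two_pi_sub, ← h] at h'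
        have := mul_right_cancel₀ hφ.ne' (h'.trans (neg_mul _ _).symm)
        rw [this, add_neg_cancel]
      rw [this]
      simp only [mul_zero, and_self]
  rw [hcoef1.1, hcoef1.2, zero_smul, zero_smul, add_zero, add_zero]

/-- The geometric representation of the Coxeter group. -/
noncomputable def geomRep : M.Group →* ((B →₀ ℝ) ≃ₗ[ℝ] (B →₀ ℝ)) :=
  M.toCoxeterSystem.lift ⟨rootReflection M, rootReflection_mul_pow M⟩

theorem geomRep_simple (s : B) :
    geomRep M (M.toCoxeterSystem.simple s) = rootReflection M s :=
  M.toCoxeterSystem.lift_apply_simple _ s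

/-- The numbers `sin (k θ) / sin θ`, defined by their recurrence so that they make sense for
`θ = 0`. -/
noncomputable def sinRatio (θ : ℝ) : ℕ → ℝ
  | 0 => 0
  | 1 => 1
  | k + 2 => 2 * cos θ * sinRatio θ (k + 1) - sinRatio θ k

theorem sinRatio_zero (θ : ℝ) : sinRatio θ 0 = 0 := rfl

theorem sinRatio_one (θ : ℝ) : sinRatio θ 1 = 1 := rfl

theorem sinRatio_mul_sin (θ : ℝ) (k : ℕ) : sinRatio θ k * sin θ = sin (k * θ) := by
  induction k using Nat.twoStepInduction with
  | zero => simp [sinRatio]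
  | one => simp [sinRatio]
  | more k ih1 ih2 =>
    have h1 : sin ((k + 2 : ℕ) * θ) = sin ((k + 1 : ℕ) * θ + θ) := by push_cast; ring_nf
    have h2 : sin (k * θ) = sin ((k + 1 : ℕ) * θ - θ) := by push_cast; ring_nf
    rw [h1, sin_add]
    rw [h2, sin_sub] at ih1
    rw [sinRatio]
    linear_combination 2 * cos θ * ih2 - ih1

theorem sinRatio_zero_angle (k : ℕ) : sinRatio 0 k = k := by
  induction k using Nat.twoStepInduction with
  | zero => simp [sinRatio]
  | one => simp [sinRatio]
  | more k ih1 ih2 =>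
    rw [sinRatio, ih1, ih2, cos_zero]
    push_cast
    ring

theorem sinRatio_nonneg {m k : ℕ} (hm : m ≠ 1) (hk : m = 0 ∨ k ≤ m) :
    0 ≤ sinRatio (π / m) k := by
  obtain rfl | hm0 := eq_or_ne m 0
  · simp [sinRatio_zero_angle]
  have hkm : k ≤ m := hk.resolve_left hm0
  have hmR : (2 : ℝ) ≤ m := by exact_mod_cast (by omega : 2 ≤ m)
  have hkR : (k : ℝ) ≤ m := by exact_mod_cast hkm
  have hmpos : (0 : ℝ) < m := by linarith
  have hs : 0 < sin (π / m) := by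
    apply sin_pos_of_pos_of_lt_pi
    · have := pi_pos; positivity
    · rw [div_lt_iff₀ hmpos]
      nlinarith [pi_pos]
  have h := sinRatio_mul_sin (π / m) k
  have h2 : 0 ≤ sin (k * (π / m)) := by
    apply sin_nonneg_of_nonneg_of_le_pi
    · have := pi_pos; positivity
    · rw [← mul_div_assoc, div_le_iff₀ hmpos]
      nlinarith [pi_pos]
  rw [← h] at h2
  exact nonneg_of_mul_nonneg_left h2 hs

theorem rootReflection_simpleRoot_combination (s t : B) (a b : ℝ) :
    rootReflection M t (a • simpleRoot s + b • simpleRoot t) =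
      a • simpleRoot s + (2 * cos (π / M s t) * a - b) • simpleRoot t := by
  have hsym : M t s = M s t := M.symmetric t s
  rw [rootReflection_apply, map_add, map_smul, map_smul, simpleCoroot_simpleRoot_self,
    simpleCoroot_simpleRoot, hsym, smul_eq_mul, smul_eq_mul]
  module

theorem geomRep_altList_inv (s t : B) (j k : ℕ) :
    geomRep M (M.toCoxeterSystem.wordProd (altList t s k))⁻¹
        (sinRatio (π / M s t) (j + 1) • simpleRoot s + sinRatio (π / M s t) j • simpleRoot t) =
      sinRatio (π / M s t) (j + k + 1) • simpleRoot (altNext s t k) +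
        sinRatio (π / M s t) (j + k) • simpleRoot (altNext t s k) := by
  have hsym (s t : B) : M t s = M s t := M.symmetric t s
  induction k generalizing s t j with
  | zero => simp [altList, altNext]
  | succ k ih =>
    rw [altList, CoxeterSystem.wordProd_cons, mul_inv_rev, CoxeterSystem.inv_simple, map_mul,
      LinearEquiv.mul_apply, geomRep_simple, rootReflection_simpleRoot_combination]
    have h := ih t s (j + 1)
    rw [hsym s t, add_comm (sinRatio _ (j + 1 + 1) • _), sinRatio] at h
    rw [h, altNext_succ, altNext_succ, show j + 1 + k = j + (k + 1) by omega]

/-- The image of the next simple root under an alternating word. -/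
theorem geomRep_altList (s t : B) (k : ℕ) :
    ∃ x y : B, ((x = s ∧ y = t) ∨ (x = t ∧ y = s)) ∧
      geomRep M (M.toCoxeterSystem.wordProd (altList s t k)) (simpleRoot (altNext s t k)) =
        sinRatio (π / M s t) (k + 1) • simpleRoot x + sinRatio (π / M s t) k • simpleRoot y := by
  have h1 := congrArg List.reverse (reverse_altList s t k)
  rw [List.reverse_reverse] at h1
  have h := geomRep_altList_inv M (altNext s t k) (altNext t s k) 0 k
  have hm : M (altNext s t k) (altNext t s k) = M s t := by
    obtain ⟨h1, h2⟩ | ⟨h1, h2⟩ := altNext_eq_or s t k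
    · rw [h1, h2]
    · rw [h1, h2]; exact M.symmetric t s
  rw [← CoxeterSystem.wordProd_reverse, ← h1, hm] at h
  simp only [sinRatio, zero_add, one_smul, zero_smul, add_zero] at h
  refine ⟨_, _, ?_, h⟩
  obtain ⟨h1, h2⟩ | ⟨h1, h2⟩ := altNext_eq_or s t k
  · rw [h1, h2]; exact altNext_eq_or s t k
  · rw [h1, h2]; exact (altNext_eq_or t s k).symm

end GeometricRepresentation

section CoxeterCombinatorics

variable (M : CoxeterMatrix B)

local notation "ℓ" => CoxeterSystem.length (CoxeterMatrix.toCoxeterSystem M)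
local notation "𝐬" => CoxeterSystem.simple (CoxeterMatrix.toCoxeterSystem M)
local notation "𝐰" => CoxeterSystem.wordProd (CoxeterMatrix.toCoxeterSystem M)

theorem simpleRoot_nonneg (s : B) : 0 ≤ simpleRoot s := by
  rw [simpleRoot, Finsupp.single_nonneg]
  exact zero_le_one

theorem wordProd_altList_succ' (s t : B) (k : ℕ) :
    𝐰 (altList s t (k + 1)) = 𝐰 (altList s t k) * 𝐬 (altNext s t k) := by
  rw [altList_succ', CoxeterSystem.wordProd_append, CoxeterSystem.wordProd_singleton]

theorem wordProd_altList_comm (s t : B) :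
    𝐰 (altList s t (M s t)) = 𝐰 (altList t s (M s t)) := by
  have hsym : M s t = M t s := M.symmetric s t
  have hb := M.toCoxeterSystem.wordProd_braidWord_eq t s
  rw [CoxeterSystem.braidWord, CoxeterSystem.braidWord, ← hsym] at hb
  rw [altList_eq_reverse_alternatingWord, altList_eq_reverse_alternatingWord,
    CoxeterSystem.wordProd_reverse, CoxeterSystem.wordProd_reverse, hb]

theorem length_wordProd_altList_le (s t : B) (k : ℕ) : ℓ (𝐰 (altList s t k)) ≤ k :=
  (M.toCoxeterSystem.length_wordProd_le _).trans_eq (length_altList s t k)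

/-- A simple root which is sent to a nonnegative vector is not a descent: this is the
fundamental property of the geometric representation. -/
theorem geomRep_simpleRoot_nonneg (w : M.Group) (s : B) (h : ℓ (w * 𝐬 s) = ℓ w + 1) :
    0 ≤ geomRep M w (simpleRoot s) := by
  induction hn : ℓ w using Nat.strong_induction_on generalizing w s with
  | _ n ih =>
  subst hn
  obtain rfl | hw := eq_or_ne w 1
  · rw [map_one]
    exact simpleRoot_nonneg s
  obtain ⟨t, ht⟩ := M.toCoxeterSystem.exists_rightDescent_of_ne_one hw
  rw [CoxeterSystem.isRightDescent_iff] at ht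
  have hst : t ≠ s := by
    rintro rfl
    omega
  classical
  have hex : ∃ k, ℓ (w * 𝐰 (altList t s k)) + k ≠ ℓ w := ⟨ℓ w + 1, by omega⟩
  obtain ⟨k, hk⟩ : ∃ k, Nat.find hex = k + 2 := by
    have h0 : Nat.find hex ≠ 0 := fun h0 => by
      have := Nat.find_spec hex
      rw [h0] at this
      simp [altList] at this
    have h1 : Nat.find hex ≠ 1 := fun h1 => by
      have := Nat.find_spec hex
      rw [h1] at this
      simp [altList, CoxeterSystem.wordProd_cons,
        -CoxeterMatrix.toCoxeterSystem_simple] at this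
      omega
    exact ⟨Nat.find hex - 2, by omega⟩
  have hP (j : ℕ) (hj : j ≤ k + 1) : ℓ (w * 𝐰 (altList t s j)) + j = ℓ w :=
    not_not.mp (Nat.find_min hex (by omega))
  have hnP := Nat.find_spec hex
  rw [hk] at hnP
  obtain ⟨v, hv⟩ : ∃ v, v = w * 𝐰 (altList t s (k + 1)) := ⟨_, rfl⟩
  have hlv := hP (k + 1) le_rfl
  rw [← hv] at hlv
  have hv1 : ℓ (v * 𝐬 (altNext t s (k + 1))) = ℓ v + 1 := by
    rw [wordProd_altList_succ', ← mul_assoc, ← hv] at hnP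
    have := M.toCoxeterSystem.length_mul_simple v (altNext t s (k + 1))
    omega
  have hv2 : ℓ (v * 𝐬 (altNext s t (k + 1))) = ℓ v + 1 := by
    rw [hv, wordProd_altList_succ', altNext_succ, ← mul_assoc,
      CoxeterSystem.simple_mul_simple_cancel_right, mul_assoc, ← wordProd_altList_succ', ← hv]
    have := hP k (by omega)
    omega
  have hr1 := ih (ℓ v) (by omega) v _ hv1 rfl
  have hr2 := ih (ℓ v) (by omega) v _ hv2 rfl
  have hkm : M s t = 0 ∨ k + 2 ≤ M s t := by
    by_contra! hcon
    obtain ⟨j, hj⟩ := Nat.exists_eq_succ_of_ne_zero hcon.1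
    have h1 := hP (M s t) (by omega)
    have hsym : M t s = M s t := M.symmetric t s
    have hcomm := wordProd_altList_comm M t s
    rw [hsym] at hcomm
    rw [hcomm, hj, altList, CoxeterSystem.wordProd_cons, ← mul_assoc] at h1
    have h2 := M.toCoxeterSystem.length_le_length_mul_add_right (w * 𝐬 s) (𝐰 (altList t s j))
    have h3 := length_wordProd_altList_le M t s j
    omega
  have hact := geomRep_altList_inv M s t 0 (k + 1)
  simp only [sinRatio_zero, sinRatio_one, zero_add, one_smul, zero_smul, add_zero] at hact
  have hwv : w = v * (𝐰 (altList t s (k + 1)))⁻¹ := by rw [hv, mul_inv_cancel_right]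
  rw [hwv, map_mul, LinearEquiv.mul_apply, hact, map_add, map_smul, map_smul]
  have hm1 : M s t ≠ 1 := M.off_diagonal s t hst.symm
  exact add_nonneg (smul_nonneg (sinRatio_nonneg hm1 (hkm.imp_right (by omega))) hr2)
    (smul_nonneg (sinRatio_nonneg hm1 (hkm.imp_right (by omega))) hr1)

theorem geomRep_simpleRoot_nonpos (w : M.Group) (s : B) (h : ℓ (w * 𝐬 s) + 1 = ℓ w) :
    geomRep M w (simpleRoot s) ≤ 0 := by
  have h1 := geomRep_simpleRoot_nonneg M (w * 𝐬 s) s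
    (by rw [CoxeterSystem.simple_mul_simple_cancel_right, h])
  rw [map_mul, LinearEquiv.mul_apply, geomRep_simple, rootReflection,
    Module.reflection_apply_self, map_neg] at h1
  exact neg_nonneg.mp h1

theorem geomRep_simpleRoot_ne_zero (w : M.Group) (s : B) : geomRep M w (simpleRoot s) ≠ 0 := by
  rw [Ne, LinearEquiv.map_eq_zero_iff, simpleRoot, Finsupp.single_eq_zero]
  exact one_ne_zero

theorem length_mul_simple_of_nonneg (w : M.Group) (s : B)
    (h : 0 ≤ geomRep M w (simpleRoot s)) : ℓ (w * 𝐬 s) = ℓ w + 1 :=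
  (M.toCoxeterSystem.length_mul_simple w s).resolve_right fun h' =>
    geomRep_simpleRoot_ne_zero M w s (le_antisymm (geomRep_simpleRoot_nonpos M w s h') h)

theorem length_mul_simple_of_nonpos (w : M.Group) (s : B)
    (h : geomRep M w (simpleRoot s) ≤ 0) : ℓ (w * 𝐬 s) + 1 = ℓ w :=
  (M.toCoxeterSystem.length_mul_simple w s).resolve_left fun h' =>
    geomRep_simpleRoot_ne_zero M w s (le_antisymm h (geomRep_simpleRoot_nonneg M w s h'))

variable {s t : B}

theorem length_mul_altList (hst : s ≠ t) {w : M.Group} (hs : ℓ (w * 𝐬 s) = ℓ w + 1)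
    (ht : ℓ (w * 𝐬 t) = ℓ w + 1) {k : ℕ} (hk : M s t = 0 ∨ k ≤ M s t) :
    ℓ (w * 𝐰 (altList s t k)) = ℓ w + k := by
  induction k with
  | zero => simp [altList]
  | succ k ih =>
    rw [wordProd_altList_succ', ← mul_assoc, length_mul_simple_of_nonneg, ih, add_assoc]
    · exact hk.imp_right (by omega)
    · have hm1 : M s t ≠ 1 := M.off_diagonal s t hst
      have hs' := geomRep_simpleRoot_nonneg M w s hs
      have ht' := geomRep_simpleRoot_nonneg M w t ht
      obtain ⟨x, y, hxy, h⟩ := geomRep_altList M s t k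
      rw [map_mul, LinearEquiv.mul_apply, h, map_add, map_smul, map_smul]
      have h1 := sinRatio_nonneg hm1 hk
      have h2 := sinRatio_nonneg hm1 (hk.imp_right (by omega : k + 1 ≤ M s t → k ≤ M s t))
      obtain ⟨rfl, rfl⟩ | ⟨rfl, rfl⟩ := hxy
      · exact add_nonneg (smul_nonneg h1 hs') (smul_nonneg h2 ht')
      · exact add_nonneg (smul_nonneg h1 ht') (smul_nonneg h2 hs')

theorem length_mul_altList_of_descents (hst : s ≠ t) {w : M.Group} (hs : ℓ (w * 𝐬 s) + 1 = ℓ w)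
    (ht : ℓ (w * 𝐬 t) + 1 = ℓ w) {k : ℕ} (hk : M s t = 0 ∨ k ≤ M s t) :
    ℓ (w * 𝐰 (altList s t k)) + k = ℓ w := by
  induction k with
  | zero => simp [altList]
  | succ k ih =>
    rw [wordProd_altList_succ', ← mul_assoc, ← ih (hk.imp_right (by omega)),
      ← length_mul_simple_of_nonpos M (w * 𝐰 (altList s t k)) (altNext s t k), add_assoc,
      add_comm 1 k]
    have hm1 : M s t ≠ 1 := M.off_diagonal s t hst
    have hs' := geomRep_simpleRoot_nonpos M w s hs
    have ht' := geomRep_simpleRoot_nonpos M w t ht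
    obtain ⟨x, y, hxy, h⟩ := geomRep_altList M s t k
    rw [map_mul, LinearEquiv.mul_apply, h, map_add, map_smul, map_smul]
    have h1 := sinRatio_nonneg hm1 hk
    have h2 := sinRatio_nonneg hm1 (hk.imp_right (by omega : k + 1 ≤ M s t → k ≤ M s t))
    obtain ⟨rfl, rfl⟩ | ⟨rfl, rfl⟩ := hxy
    · exact add_nonpos (smul_nonpos_of_nonneg_of_nonpos h1 hs')
        (smul_nonpos_of_nonneg_of_nonpos h2 ht')
    · exact add_nonpos (smul_nonpos_of_nonneg_of_nonpos h1 ht')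
        (smul_nonpos_of_nonneg_of_nonpos h2 hs')

theorem length_wordProd_altList (hst : s ≠ t) {k : ℕ} (hk : M s t = 0 ∨ k ≤ M s t) :
    ℓ (𝐰 (altList s t k)) = k := by
  have h (r : B) : ℓ (1 * 𝐬 r) = ℓ 1 + 1 := by
    rw [one_mul, CoxeterSystem.length_simple, CoxeterSystem.length_one]
  simpa using length_mul_altList M hst (h s) (h t) hk

theorem coxeterMatrix_ne_zero_of_finite [Finite M.Group] (s t : B) : M s t ≠ 0 := by
  obtain rfl | hst := eq_or_ne s t
  · rw [M.diagonal]
    exact one_ne_zero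
  intro h
  refine not_injective_infinite_finite (fun k : ℕ => 𝐰 (altList s t k)) fun j k hjk => ?_
  have := congrArg ℓ hjk
  rwa [length_wordProd_altList M hst (.inl h), length_wordProd_altList M hst (.inl h)] at this

/-- The (right) weak order on the Coxeter group: `u` is a prefix of `v`. -/
def WeakLE (u v : M.Group) : Prop := ℓ u + ℓ (u⁻¹ * v) = ℓ v

variable {M}

theorem WeakLE.refl (u : M.Group) : WeakLE M u u := by simp [WeakLE]

theorem WeakLE.one_left (u : M.Group) : WeakLE M 1 u := by simp [WeakLE]

theorem WeakLE.trans {u v w : M.Group} (huv : WeakLE M u v) (hvw : WeakLE M v w) :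
    WeakLE M u w := by
  have h1 := M.toCoxeterSystem.length_mul_le (u⁻¹ * v) (v⁻¹ * w)
  have h2 := M.toCoxeterSystem.length_mul_le u (u⁻¹ * w)
  rw [mul_assoc, mul_inv_cancel_left] at h1
  rw [mul_inv_cancel_left] at h2
  unfold WeakLE at *
  omega

theorem weakLE_mul_iff {z x : M.Group} : WeakLE M z (z * x) ↔ ℓ (z * x) = ℓ z + ℓ x := by
  rw [WeakLE, inv_mul_cancel_left, eq_comm]

theorem WeakLE.mul_left_iff {z x w : M.Group} (hzx : WeakLE M z (z * x)) (hzw : WeakLE M z w) :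
    WeakLE M (z * x) w ↔ WeakLE M x (z⁻¹ * w) := by
  rw [weakLE_mul_iff] at hzx
  unfold WeakLE at *
  rw [mul_inv_rev, mul_assoc, hzx]
  omega

theorem weakLE_simple_iff {s : B} {w : M.Group} : WeakLE M (𝐬 s) w ↔ ℓ (𝐬 s * w) + 1 = ℓ w := by
  rw [WeakLE, CoxeterSystem.length_simple, CoxeterSystem.inv_simple, add_comm]

theorem weakLE_altList {s t : B} (hst : s ≠ t) {w : M.Group} (hs : WeakLE M (𝐬 s) w)
    (ht : WeakLE M (𝐬 t) w) : WeakLE M (𝐰 (altList s t (M s t))) w := by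
  rw [weakLE_simple_iff] at hs ht
  have hinv (x : M.Group) : ℓ (w⁻¹ * x) = ℓ (x⁻¹ * w) := by
    rw [← M.toCoxeterSystem.length_inv, mul_inv_rev, inv_inv]
  have h := length_mul_altList_of_descents M hst (w := w⁻¹) (k := M s t)
    (by rw [hinv, CoxeterSystem.inv_simple, CoxeterSystem.length_inv, hs])
    (by rw [hinv, CoxeterSystem.inv_simple, CoxeterSystem.length_inv, ht]) (.inr le_rfl)
  rw [hinv, CoxeterSystem.length_inv] at h
  rw [WeakLE, length_wordProd_altList M hst (.inr le_rfl), add_comm, h]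

theorem simple_weakLE_altList {s t : B} (hst : s ≠ t) (hm : M s t ≠ 0) :
    WeakLE M (𝐬 s) (𝐰 (altList s t (M s t))) := by
  have hsym : M t s = M s t := M.symmetric t s
  rw [weakLE_simple_iff, length_wordProd_altList M hst (.inr le_rfl)]
  obtain ⟨k, hk⟩ := Nat.exists_eq_succ_of_ne_zero hm
  rw [hk, altList, CoxeterSystem.wordProd_cons, CoxeterSystem.simple_mul_simple_cancel_left,
    length_wordProd_altList M hst.symm (.inr (by omega))]

theorem simple_weakLE_altList' {s t : B} (hst : s ≠ t) (hm : M s t ≠ 0) :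
    WeakLE M (𝐬 t) (𝐰 (altList s t (M s t))) := by
  have hsym : M s t = M t s := M.symmetric s t
  rw [wordProd_altList_comm, hsym]
  exact simple_weakLE_altList hst.symm (hsym ▸ hm)

/-- The covering relation of the weak order. -/
def WeakCovBy (z x : M.Group) : Prop := ∃ s, x = z * 𝐬 s ∧ ℓ x = ℓ z + 1

theorem WeakCovBy.weakLE {z x : M.Group} (h : WeakCovBy z x) : WeakLE M z x := by
  obtain ⟨s, rfl, h⟩ := h
  rw [weakLE_mul_iff, h, CoxeterSystem.length_simple]

theorem WeakLE.eq_or_exists_covBy {z x : M.Group} (h : WeakLE M z x) :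
    z = x ∨ ∃ y, WeakCovBy z y ∧ WeakLE M y x := by
  by_cases hzx : z⁻¹ * x = 1
  · exact .inl (inv_mul_eq_one.mp hzx)
  obtain ⟨s, hs⟩ := M.toCoxeterSystem.exists_leftDescent_of_ne_one hzx
  rw [CoxeterSystem.isLeftDescent_iff] at hs
  have h1 := M.toCoxeterSystem.length_mul_le (z * 𝐬 s) (𝐬 s * (z⁻¹ * x))
  rw [mul_assoc, CoxeterSystem.simple_mul_simple_cancel_left, mul_inv_cancel_left] at h1
  have hz := M.toCoxeterSystem.length_mul_simple z s
  have h' := h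
  rw [WeakLE] at h'
  have hcov : WeakCovBy z (z * 𝐬 s) := ⟨s, rfl, by omega⟩
  exact .inr ⟨_, hcov, (hcov.weakLE.mul_left_iff h).mpr (weakLE_simple_iff.mpr hs)⟩

/-- `j` is a least upper bound of `x` and `y` for the relation `le`. -/
def IsJoin {X : Type*} (le : X → X → Prop) (x y j : X) : Prop :=
  le x j ∧ le y j ∧ ∀ w, le x w → le y w → le j w

/-- A graded preorder in which elements with a common lower cover have a join has all bounded
joins (relative to a lower set `D` of bounded rank). -/
theorem exists_isJoin_of_covers {X : Type*} (le cov : X → X → Prop) (D : X → Prop) (rk : X → ℕ)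
    (N : ℕ) (hrefl : ∀ x, le x x) (htrans : ∀ x y z, le x y → le y z → le x z)
    (hD : ∀ x y, le x y → D y → D x) (hN : ∀ x, D x → rk x ≤ N)
    (hcov : ∀ z x, cov z x → le z x ∧ rk z < rk x)
    (hex : ∀ z x, le z x → z = x ∨ ∃ y, cov z y ∧ le y x)
    (hjoin : ∀ z x y, cov z x → cov z y → D x → D y → ∃ j, D j ∧ IsJoin le x y j)
    (z x y : X) (hzx : le z x) (hzy : le z y) (hx : D x) (hy : D y) :
    ∃ j, D j ∧ IsJoin le x y j := by
  induction hn : N - rk z using Nat.strong_induction_on generalizing z x y with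
  | _ n ih =>
  obtain rfl | ⟨x₁, hzx₁, hx₁⟩ := hex z x hzx
  · exact ⟨y, hy, hzy, hrefl y, fun w _ h => h⟩
  obtain rfl | ⟨y₁, hzy₁, hy₁⟩ := hex z y hzy
  · exact ⟨x, hx, hrefl x, hzx, fun w h _ => h⟩
  have hDx₁ := hD _ _ hx₁ hx
  have hDy₁ := hD _ _ hy₁ hy
  have hrx := (hcov _ _ hzx₁).2
  have hry := (hcov _ _ hzy₁).2
  have hNx := hN _ hDx₁
  have hNy := hN _ hDy₁
  obtain ⟨j₀, hj₀, hxj₀, hyj₀, hu₀⟩ := hjoin z x₁ y₁ hzx₁ hzy₁ hDx₁ hDy₁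
  obtain ⟨j₁, hj₁, hxj₁, hjj₁, hu₁⟩ := ih _ (by omega) x₁ x j₀ hx₁ hxj₀ hx hj₀ rfl
  obtain ⟨j₂, hj₂, hyj₂, hjj₂, hu₂⟩ := ih _ (by omega) y₁ y j₀ hy₁ hyj₀ hy hj₀ rfl
  obtain ⟨j, hj, hj₁j, hj₂j, hu⟩ := ih _ (by omega) x₁ j₁ j₂ (htrans _ _ _ hx₁ hxj₁)
    (htrans _ _ _ hxj₀ hjj₂) hj₁ hj₂ rfl
  refine ⟨j, hj, htrans _ _ _ hxj₁ hj₁j, htrans _ _ _ hyj₂ hj₂j, fun w hxw hyw => ?_⟩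
  have hj₀w := hu₀ w (htrans _ _ _ hx₁ hxw) (htrans _ _ _ hy₁ hyw)
  exact hu w (hu₁ w hxw hj₀w) (hu₂ w hyw hj₀w)

theorem length_mul_altList_of_weakCovBy {z : M.Group} {s t : B} (hst : s ≠ t)
    (hs : ℓ (z * 𝐬 s) = ℓ z + 1) (ht : ℓ (z * 𝐬 t) = ℓ z + 1) :
    WeakLE M z (z * 𝐰 (altList s t (M s t))) := by
  rw [weakLE_mul_iff, length_mul_altList M hst hs ht (.inr le_rfl),
    length_wordProd_altList M hst (.inr le_rfl)]

theorem isJoin_weakLE_altList {z : M.Group} {s t : B} (hst : s ≠ t) (hm : M s t ≠ 0)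
    (hs : ℓ (z * 𝐬 s) = ℓ z + 1) (ht : ℓ (z * 𝐬 t) = ℓ z + 1) :
    IsJoin (WeakLE M) (z * 𝐬 s) (z * 𝐬 t) (z * 𝐰 (altList s t (M s t))) := by
  have hzs : WeakCovBy z (z * 𝐬 s) := ⟨s, rfl, hs⟩
  have hzt : WeakCovBy z (z * 𝐬 t) := ⟨t, rfl, ht⟩
  have hz := length_mul_altList_of_weakCovBy hst hs ht
  refine ⟨?_, ?_, fun w hsw htw => ?_⟩
  · rw [hzs.weakLE.mul_left_iff hz, inv_mul_cancel_left]
    exact simple_weakLE_altList hst hm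
  · rw [hzt.weakLE.mul_left_iff hz, inv_mul_cancel_left]
    exact simple_weakLE_altList' hst hm
  · have hzw := hzs.weakLE.trans hsw
    rw [hzs.weakLE.mul_left_iff hzw] at hsw
    rw [hzt.weakLE.mul_left_iff hzw] at htw
    rw [hz.mul_left_iff hzw]
    exact weakLE_altList hst hsw htw

variable (M) in
theorem exists_weakLE_top [Finite M.Group] : ∃ w₀ : M.Group, ∀ w, WeakLE M w w₀ := by
  obtain ⟨w₀, hw₀⟩ := Finite.exists_max (ℓ)
  refine ⟨w₀, fun w => ?_⟩
  obtain ⟨j, -, hwj, hw₀j, -⟩ := exists_isJoin_of_covers (WeakLE M) WeakCovBy (fun _ => True) ℓ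
    (ℓ w₀) WeakLE.refl (fun _ _ _ => WeakLE.trans) (fun _ _ _ _ => trivial) (fun x _ => hw₀ x)
    (fun z x h => ⟨h.weakLE, by obtain ⟨s, -, h⟩ := h; omega⟩)
    (fun z x h => h.eq_or_exists_covBy)
    (fun z x y ⟨s, hx, hs⟩ ⟨t, hy, ht⟩ _ _ => by
      subst hx hy
      obtain rfl | hst := eq_or_ne s t
      · exact ⟨z * 𝐬 s, trivial, .refl _, .refl _, fun w h _ => h⟩
      · exact ⟨_, trivial,
          isJoin_weakLE_altList hst (coxeterMatrix_ne_zero_of_finite M s t) hs ht⟩)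
    1 w w₀ (.one_left w) (.one_left w₀) trivial trivial
  have h := hw₀ j
  have h' := hw₀j
  rw [WeakLE] at h'
  have : w₀⁻¹ * j = 1 := M.toCoxeterSystem.length_eq_zero_iff.mp (by omega)
  rwa [inv_mul_eq_one.mp this]

end CoxeterCombinatorics

/-- Two words are braid equivalent if they are related by a chain of braid moves. -/
inductive BraidEq (M : CoxeterMatrix B) : List B → List B → Prop
  | refl (l : List B) : BraidEq M l l
  | symm {l l' : List B} : BraidEq M l l' → BraidEq M l' l
  | trans {l l' l'' : List B} : BraidEq M l l' → BraidEq M l' l'' → BraidEq M l l''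
  | cons (s : B) {l l' : List B} : BraidEq M l l' → BraidEq M (s :: l) (s :: l')
  | braid {s t : B} (l : List B) : s ≠ t → M s t ≠ 0 →
      BraidEq M (altList s t (M s t) ++ l) (altList t s (M s t) ++ l)

section BraidMonoid

variable {M : CoxeterMatrix B}

theorem BraidEq.append_left (k : List B) {l l' : List B} (h : BraidEq M l l') :
    BraidEq M (k ++ l) (k ++ l') := by
  induction k with
  | nil => exact h
  | cons s k ih => exact ih.cons s

theorem BraidEq.append_right (k : List B) {l l' : List B} (h : BraidEq M l l') :
    BraidEq M (l ++ k) (l' ++ k) := by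
  induction h with
  | refl l => exact .refl _
  | symm _ ih => exact ih.symm
  | trans _ _ ih ih' => exact ih.trans ih'
  | cons s _ ih => exact ih.cons s
  | braid l hst hm =>
    rw [append_assoc, append_assoc]
    exact .braid _ hst hm

theorem BraidEq.length_eq {l l' : List B} (h : BraidEq M l l') : l.length = l'.length := by
  induction h with
  | refl l => rfl
  | symm _ ih => exact ih.symm
  | trans _ _ ih ih' => exact ih.trans ih'
  | cons s _ ih => simp [ih]
  | braid l hst hm => simp

theorem braidEq_altList {s t : B} (hst : s ≠ t) (hm : M s t ≠ 0) :
    BraidEq M (altList s t (M s t)) (altList t s (M s t)) := by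
  simpa using BraidEq.braid [] hst hm

theorem BraidEq.reverse {l l' : List B} (h : BraidEq M l l') :
    BraidEq M l.reverse l'.reverse := by
  induction h with
  | refl l => exact .refl _
  | symm _ ih => exact ih.symm
  | trans _ _ ih ih' => exact ih.trans ih'
  | cons s _ ih =>
    rw [reverse_cons, reverse_cons]
    exact ih.append_right _
  | @braid s t l hst hm =>
    rw [reverse_append, reverse_append]
    refine .append_left _ ?_
    rw [reverse_altList, reverse_altList]
    obtain ⟨h, h'⟩ | ⟨h, h'⟩ := altNext_eq_or s t (M s t)
    · rw [h, h']
      exact (braidEq_altList hst hm).symm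
    · rw [h, h']
      exact braidEq_altList hst hm

variable (M)

/-- The congruence on words generated by the braid relations. -/
def braidCon : Con (FreeMonoid B) where
  r a b := BraidEq M a.toList b.toList
  iseqv := ⟨fun _ => .refl _, .symm, .trans⟩
  mul' h h' := (h.append_right _).trans (h'.append_left _)

/-- The Artin-Tits monoid, presented by the braid relations. -/
def BraidMonoid : Type _ := (braidCon M).Quotient

instance : Monoid (BraidMonoid M) := inferInstanceAs (Monoid (braidCon M).Quotient)

/-- The element of the Artin-Tits monoid represented by a word. -/
def word (l : List B) : BraidMonoid M := (braidCon M).mk' (FreeMonoid.ofList l)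

variable {M}

theorem word_eq_iff {l l' : List B} : word M l = word M l' ↔ BraidEq M l l' :=
  (braidCon M).eq

theorem word_append (l l' : List B) : word M (l ++ l') = word M l * word M l' := rfl

theorem word_nil : word M [] = 1 := rfl

theorem word_cons (s : B) (l : List B) : word M (s :: l) = word M [s] * word M l := rfl

theorem word_surjective : Function.Surjective (word M) := fun a =>
  (Con.mk'_surjective a).imp fun _ h => h

theorem word_altList_comm {s t : B} (hst : s ≠ t) (hm : M s t ≠ 0) :
    word M (altList s t (M s t)) = word M (altList t s (M s t)) :=
  word_eq_iff.mpr (braidEq_altList hst hm)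

/-- Maps out of the Artin-Tits monoid. -/
def braidLift {N : Type*} [Monoid N] (f : B → N)
    (hf : ∀ s t, s ≠ t → M s t ≠ 0 →
      ((altList s t (M s t)).map f).prod = ((altList t s (M s t)).map f).prod) :
    BraidMonoid M →* N :=
  (braidCon M).lift (FreeMonoid.lift f) fun a b h => by
    have key (l l' : List B) (h : BraidEq M l l') : (l.map f).prod = (l'.map f).prod := by
      induction h with
      | refl l => rfl
      | symm _ ih => exact ih.symm
      | trans _ _ ih ih' => exact ih.trans ih'
      | cons s _ ih => simp [ih]
      | braid l hst hm => simp [hf _ _ hst hm]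
    simpa [Con.ker_rel, FreeMonoid.lift_apply] using key _ _ h

theorem braidLift_word {N : Type*} [Monoid N] (f : B → N)
    (hf : ∀ s t, s ≠ t → M s t ≠ 0 →
      ((altList s t (M s t)).map f).prod = ((altList t s (M s t)).map f).prod) (l : List B) :
    braidLift f hf (word M l) = (l.map f).prod :=
  FreeMonoid.lift_apply f _

/-- The length of an element of the Artin-Tits monoid. -/
def size (a : BraidMonoid M) : ℕ :=
  Con.liftOn a (fun l => l.toList.length) fun _ _ h => BraidEq.length_eq h

theorem size_word (l : List B) : size (word M l) = l.length := rfl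

theorem size_mul (a b : BraidMonoid M) : size (a * b) = size a + size b := by
  obtain ⟨a, rfl⟩ := word_surjective a
  obtain ⟨b, rfl⟩ := word_surjective b
  rw [← word_append, size_word, size_word, size_word, length_append]

theorem eq_one_of_size_eq_zero {a : BraidMonoid M} (h : size a = 0) : a = 1 := by
  obtain ⟨a, rfl⟩ := word_surjective a
  rw [size_word, length_eq_zero_iff] at h
  rw [h, word_nil]

/-- The reversal anti-automorphism of the Artin-Tits monoid. -/
def rev (a : BraidMonoid M) : BraidMonoid M :=
  Con.liftOn a (fun l => word M l.toList.reverse) fun _ _ h => word_eq_iff.mpr (BraidEq.reverse h)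

theorem rev_word (l : List B) : rev (word M l) = word M l.reverse := rfl

theorem rev_mul (a b : BraidMonoid M) : rev (a * b) = rev b * rev a := by
  obtain ⟨a, rfl⟩ := word_surjective a
  obtain ⟨b, rfl⟩ := word_surjective b
  rw [← word_append, rev_word, rev_word, rev_word, reverse_append, word_append]

theorem rev_rev (a : BraidMonoid M) : rev (rev a) = a := by
  obtain ⟨a, rfl⟩ := word_surjective a
  rw [rev_word, rev_word, reverse_reverse]

theorem eq_or_exists_mul_word_dvd {z x : BraidMonoid M} (h : z ∣ x) :
    z = x ∨ ∃ y, (∃ s, y = z * word M [s]) ∧ y ∣ x := by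
  obtain ⟨d, rfl⟩ := h
  obtain ⟨l, rfl⟩ := word_surjective d
  cases l with
  | nil => exact .inl (by rw [word_nil, mul_one])
  | cons s l => exact .inr ⟨_, ⟨s, rfl⟩, word M l, by rw [word_cons, mul_assoc]⟩

end BraidMonoid

section PosLift

variable {M : CoxeterMatrix B}

local notation "ℓ" => CoxeterSystem.length (CoxeterMatrix.toCoxeterSystem M)
local notation "𝐬" => CoxeterSystem.simple (CoxeterMatrix.toCoxeterSystem M)
local notation "𝐰" => CoxeterSystem.wordProd (CoxeterMatrix.toCoxeterSystem M)

theorem simple_mul_wordProd_altList (s t : B) {k : ℕ} (hk : k ≠ 0) :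
    𝐬 t * 𝐰 (altList s t (k - 1)) = 𝐰 (altList t s k) := by
  obtain ⟨j, rfl⟩ := Nat.exists_eq_succ_of_ne_zero hk
  rw [Nat.succ_sub_one, altList, CoxeterSystem.wordProd_cons]

theorem word_altList_pred (s t : B) {k : ℕ} (hk : k ≠ 0) :
    word M [t] * word M (altList s t (k - 1)) = word M (altList t s k) := by
  obtain ⟨j, rfl⟩ := Nat.exists_eq_succ_of_ne_zero hk
  rw [Nat.succ_sub_one, altList, ← word_cons]

theorem isReduced_of_cons {s : B} {l : List B} (h : M.toCoxeterSystem.IsReduced (s :: l)) :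
    M.toCoxeterSystem.IsReduced l := h.drop 1

variable [Finite M.Group]

/-- Matsumoto's theorem. -/
theorem word_eq_of_isReduced {l l' : List B} (hl : M.toCoxeterSystem.IsReduced l)
    (hl' : M.toCoxeterSystem.IsReduced l') (h : 𝐰 l = 𝐰 l') : word M l = word M l' := by
  induction hn : l.length using Nat.strong_induction_on generalizing l l' with
  | _ n ih =>
  subst hn
  have hlen : l.length = l'.length := by rw [← hl, h, hl']
  match l, l', hlen with
  | [], [], _ => rfl
  | s :: k, t :: k', hlen' =>
    have hk := isReduced_of_cons hl
    have hk' := isReduced_of_cons hl'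
    obtain rfl | hst := eq_or_ne s t
    · rw [CoxeterSystem.wordProd_cons, CoxeterSystem.wordProd_cons] at h
      rw [word_cons, word_cons s k', ih k.length (by simp) hk hk' (mul_left_cancel h) rfl]
    have hs : WeakLE M (𝐬 s) (𝐰 (s :: k)) := by
      rw [weakLE_simple_iff, hl, CoxeterSystem.wordProd_cons,
        CoxeterSystem.simple_mul_simple_cancel_left, hk, length_cons]
    have ht : WeakLE M (𝐬 t) (𝐰 (t :: k')) := by
      rw [weakLE_simple_iff, hl', CoxeterSystem.wordProd_cons,
        CoxeterSystem.simple_mul_simple_cancel_left, hk', length_cons]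
    have hm := coxeterMatrix_ne_zero_of_finite M s t
    have hδ := weakLE_altList hst hs (h ▸ ht)
    obtain ⟨r, hr, hrz⟩ := M.toCoxeterSystem.exists_isReduced
      ((𝐰 (altList s t (M s t)))⁻¹ * 𝐰 (s :: k))
    have key (a b : B) (q : List B) (hq : M.toCoxeterSystem.IsReduced (a :: q))
        (hqn : q.length = k.length)
        (hd : 𝐰 (altList a b (M s t)) = 𝐰 (altList s t (M s t)))
        (hqs : 𝐰 (a :: q) = 𝐰 (s :: k)) :
        word M (a :: q) = word M (altList a b (M s t)) * word M r := by
      rw [← word_altList_pred b a hm, mul_assoc, ← word_append, word_cons]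
      congr 1
      have hprod : 𝐰 (a :: (altList b a (M s t - 1) ++ r)) = 𝐰 (s :: k) := by
        rw [CoxeterSystem.wordProd_cons, CoxeterSystem.wordProd_append, ← mul_assoc,
          simple_mul_wordProd_altList b a hm, hd, ← hrz, mul_inv_cancel_left]
      refine ih q.length (by simp [hqn]) (isReduced_of_cons hq)
        (isReduced_of_cons (s := a) ?_) ?_ rfl
      · rw [WeakLE, hrz, hr, length_wordProd_altList M hst (.inr le_rfl)] at hδ
        rw [CoxeterSystem.IsReduced, hprod, ← hδ]
        simp only [length_cons, length_append, length_altList]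
        omega
      · rw [← hqs, CoxeterSystem.wordProd_cons, CoxeterSystem.wordProd_cons] at hprod
        exact (mul_left_cancel hprod).symm
    rw [key s t k hl rfl rfl rfl, word_altList_comm hst hm,
      ← key t s k' hl' (Nat.succ.inj hlen').symm (wordProd_altList_comm M s t).symm h.symm]

/-- The length-preserving section of the projection onto the Coxeter group. -/
noncomputable def posLift (w : M.Group) : BraidMonoid M :=
  word M (M.toCoxeterSystem.exists_isReduced w).choose

theorem posLift_wordProd {l : List B} (hl : M.toCoxeterSystem.IsReduced l) :
    posLift (𝐰 l) = word M l := by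
  have h := (M.toCoxeterSystem.exists_isReduced (𝐰 l)).choose_spec
  exact word_eq_of_isReduced h.1 hl h.2.symm

theorem size_posLift (w : M.Group) : size (posLift w) = ℓ w := by
  obtain ⟨l, hl, rfl⟩ := M.toCoxeterSystem.exists_isReduced w
  rw [posLift_wordProd hl, size_word, hl]

theorem posLift_mul {u v : M.Group} (h : ℓ (u * v) = ℓ u + ℓ v) :
    posLift (u * v) = posLift u * posLift v := by
  obtain ⟨l, hl, rfl⟩ := M.toCoxeterSystem.exists_isReduced u
  obtain ⟨k, hk, rfl⟩ := M.toCoxeterSystem.exists_isReduced v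
  rw [hl, hk, ← CoxeterSystem.wordProd_append, ← length_append] at h
  rw [← CoxeterSystem.wordProd_append, posLift_wordProd h, posLift_wordProd hl,
    posLift_wordProd hk, word_append]

theorem WeakLE.posLift_eq {u v : M.Group} (h : WeakLE M u v) :
    posLift v = posLift u * posLift (u⁻¹ * v) := by
  rw [← posLift_mul, mul_inv_cancel_left]
  rw [mul_inv_cancel_left, h]

theorem posLift_simple (s : B) : posLift (𝐬 s) = word M [s] := by
  rw [← M.toCoxeterSystem.wordProd_singleton, posLift_wordProd]
  rw [CoxeterSystem.IsReduced, CoxeterSystem.wordProd_singleton, CoxeterSystem.length_simple,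
    length_singleton]

theorem posLift_altList {s t : B} (hst : s ≠ t) {k : ℕ} (hk : k ≤ M s t) :
    posLift (𝐰 (altList s t k)) = word M (altList s t k) :=
  posLift_wordProd (by
    rw [CoxeterSystem.IsReduced, length_wordProd_altList M hst (.inr hk), length_altList])

end PosLift

section Reduction

variable {M : CoxeterMatrix B}

local notation "ℓ" => CoxeterSystem.length (CoxeterMatrix.toCoxeterSystem M)
local notation "𝐬" => CoxeterSystem.simple (CoxeterMatrix.toCoxeterSystem M)
local notation "𝐰" => CoxeterSystem.wordProd (CoxeterMatrix.toCoxeterSystem M)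

variable (M) in
/-- The evident sufficient condition for `s * a = t * b` to hold in the Artin-Tits monoid. -/
def HeadRel (s : B) (a : BraidMonoid M) (t : B) (b : BraidMonoid M) : Prop :=
  (s = t ∧ a = b) ∨ (s ≠ t ∧ ∃ c, a = word M (altList t s (M s t - 1)) * c ∧
    b = word M (altList s t (M s t - 1)) * c)

theorem HeadRel.symm {s t : B} {a b : BraidMonoid M} (h : HeadRel M s a t b) :
    HeadRel M t b s a := by
  have hsym : M t s = M s t := M.symmetric t s
  obtain ⟨rfl, rfl⟩ | ⟨hst, c, ha, hb⟩ := h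
  · exact .inl ⟨rfl, rfl⟩
  · exact .inr ⟨hst.symm, c, by rw [hsym, hb], by rw [hsym, ha]⟩

theorem HeadRel.eq {s : B} {a b : BraidMonoid M} (h : HeadRel M s a s b) : a = b := by
  obtain ⟨-, h⟩ | ⟨h, -⟩ := h
  · exact h
  · exact absurd rfl h

variable (M) in
/-- The reduction property `s * a = t * b → HeadRel M s a t b` for elements of length less
than `n`. -/
def HeadRelBelow (n : ℕ) : Prop :=
  ∀ (s t : B) (a b : BraidMonoid M), size a < n → word M [s] * a = word M [t] * b →
    HeadRel M s a t b

theorem HeadRelBelow.cancel_word {n : ℕ} (H : HeadRelBelow M n) {l : List B}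
    {a b : BraidMonoid M} (hn : l.length + size a ≤ n) (h : word M l * a = word M l * b) :
    a = b := by
  induction l with
  | nil => simpa [word_nil] using h
  | cons s l ih =>
    rw [length_cons] at hn
    rw [word_cons, mul_assoc, mul_assoc] at h
    refine ih (by omega) (H s s _ _ ?_ h).eq
    rw [size_mul, size_word]
    omega

variable [Finite M.Group]

theorem HeadRelBelow.cancel_posLift {n : ℕ} (H : HeadRelBelow M n) {w : M.Group}
    {a b : BraidMonoid M} (hn : ℓ w + size a ≤ n) (h : posLift w * a = posLift w * b) :
    a = b := by
  obtain ⟨l, hl, rfl⟩ := M.toCoxeterSystem.exists_isReduced w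
  rw [posLift_wordProd hl] at h
  rw [hl] at hn
  exact H.cancel_word hn h

/-- Two reduced elements dividing an element of length at most `n` have a join that still
divides it. -/
theorem HeadRelBelow.exists_join {n : ℕ} (H : HeadRelBelow M n) {b : BraidMonoid M}
    (hb : size b ≤ n) {x y : M.Group} (hx : posLift x ∣ b) (hy : posLift y ∣ b) :
    ∃ j, posLift j ∣ b ∧ IsJoin (WeakLE M) x y j := by
  refine exists_isJoin_of_covers (WeakLE M) WeakCovBy (posLift · ∣ b) ℓ n WeakLE.refl
    (fun _ _ _ => WeakLE.trans) ?_ ?_ (fun z x h => ⟨h.weakLE, by obtain ⟨s, -, h⟩ := h; omega⟩)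
    (fun z x h => h.eq_or_exists_covBy) ?_ 1 x y (.one_left x) (.one_left y) hx hy
  · intro x y hxy hy
    rw [hxy.posLift_eq] at hy
    exact dvd_of_mul_right_dvd hy
  · rintro x ⟨d, rfl⟩
    rw [size_mul, size_posLift] at hb
    omega
  · rintro z x y ⟨p, rfl, hp⟩ ⟨q, rfl, hq⟩ ⟨d, hd⟩ ⟨e, he⟩
    obtain rfl | hpq := eq_or_ne p q
    · exact ⟨z * 𝐬 p, ⟨d, hd⟩, .refl _, .refl _, fun w h _ => h⟩
    have hm := coxeterMatrix_ne_zero_of_finite M p q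
    refine ⟨_, ?_, isJoin_weakLE_altList hpq hm hp hq⟩
    have hsize := congrArg size hd
    rw [posLift_mul (by rw [hp, CoxeterSystem.length_simple]), posLift_simple, mul_assoc] at hd
    rw [posLift_mul (by rw [hq, CoxeterSystem.length_simple]), posLift_simple, mul_assoc] at he
    rw [size_mul, size_posLift, hp] at hsize
    have hcancel := H.cancel_posLift
      (by rw [size_mul, size_word, length_singleton]; omega) (hd.symm.trans he)
    obtain ⟨rfl, -⟩ | ⟨-, c, rfl, -⟩ := H p q d e (by omega) hcancel
    · exact absurd rfl hpq
    refine ⟨c, ?_⟩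
    rw [posLift_mul, posLift_altList hpq le_rfl, hd, ← word_altList_pred q p hm]
    · simp only [mul_assoc]
    · exact weakLE_mul_iff.mp (length_mul_altList_of_weakCovBy hpq hp hq)

theorem posLift_simple_mul_of_weakLE {s t : B} (hst : s ≠ t) {v : M.Group}
    (hv : WeakLE M (𝐰 (altList s t (M s t))) v) :
    posLift (𝐬 s * v) = word M (altList t s (M s t - 1)) *
      posLift ((𝐰 (altList s t (M s t)))⁻¹ * v) := by
  have hm := coxeterMatrix_ne_zero_of_finite M s t
  have hs := simple_weakLE_altList hst hm
  have hsv := hs.trans hv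
  rw [← simple_mul_wordProd_altList t s hm] at hs hv ⊢
  rw [hs.mul_left_iff hsv, CoxeterSystem.inv_simple] at hv
  rw [hv.posLift_eq, posLift_altList hst.symm, mul_inv_rev, CoxeterSystem.inv_simple, mul_assoc]
  exact (Nat.sub_le _ _).trans_eq (M.symmetric s t)

/-- If `s * a = t * b` holds through `HeadRel`, and `b = j * d` for a reduced `j` such that `v = tj`
is reduced and `j` is above the reduced element that witnesses `HeadRel`, then `s` is a prefix of
`v` and `a` is the quotient of `v` by `s`, times `d`. -/
theorem HeadRelBelow.eq_posLift_mul {n : ℕ} (H : HeadRelBelow M n) {s t : B} (hst : s ≠ t)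
    {a b c d : BraidMonoid M} {j : M.Group} (hb : size b ≤ n)
    (ha : a = word M (altList t s (M s t - 1)) * c)
    (hc : b = word M (altList s t (M s t - 1)) * c) (hd : b = posLift j * d)
    (hj : WeakLE M (𝐰 (altList s t (M s t - 1))) j) (htj : ℓ (𝐬 t * j) = ℓ j + 1) :
    WeakLE M (𝐬 s) (𝐬 t * j) ∧ a = posLift (𝐬 s * (𝐬 t * j)) * d := by
  have hm := coxeterMatrix_ne_zero_of_finite M s t
  have hv : WeakLE M (𝐬 t) (𝐬 t * j) := by
    rw [weakLE_mul_iff, htj, CoxeterSystem.length_simple, add_comm]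
  have hδ : WeakLE M (𝐰 (altList s t (M s t))) (𝐬 t * j) := by
    have hsym : M t s = M s t := M.symmetric t s
    have h := simple_weakLE_altList hst.symm (hsym ▸ hm)
    rw [hsym, ← simple_mul_wordProd_altList s t hm] at h
    rw [wordProd_altList_comm, ← simple_mul_wordProd_altList s t hm, h.mul_left_iff hv,
      inv_mul_cancel_left]
    exact hj
  refine ⟨(simple_weakLE_altList hst hm).trans hδ, ?_⟩
  have hcd : c = posLift ((𝐰 (altList s t (M s t - 1)))⁻¹ * j) * d := by
    refine H.cancel_posLift (w := 𝐰 (altList s t (M s t - 1))) ?_ ?_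
    · rw [← size_posLift, ← size_mul, posLift_altList hst (Nat.sub_le _ _), ← hc]
      exact hb
    · rw [← mul_assoc, ← hj.posLift_eq, posLift_altList hst (Nat.sub_le _ _), ← hc, hd]
  rw [posLift_simple_mul_of_weakLE hst hδ, ha, hcd, wordProd_altList_comm,
    ← simple_mul_wordProd_altList s t hm, mul_assoc]
  simp only [mul_inv_rev, mul_assoc, inv_mul_cancel_left]

theorem HeadRelBelow.trans {n : ℕ} (H : HeadRelBelow M n) {s t u : B}
    {a b c : BraidMonoid M} (hb : size b ≤ n) (hab : HeadRel M s a t b)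
    (hbc : HeadRel M t b u c) : HeadRel M s a u c := by
  replace hbc := hbc.symm
  obtain ⟨rfl, rfl⟩ | ⟨hst, x, hax, hbx⟩ := hab
  · exact hbc.symm
  obtain ⟨rfl, rfl⟩ | ⟨hut, y, hcy, hby⟩ := hbc
  · exact .inr ⟨hst, x, hax, hbx⟩
  have hdvd {s : B} (hst : s ≠ t) {x : BraidMonoid M}
      (hbx : b = word M (altList s t (M s t - 1)) * x) :
      posLift (𝐰 (altList s t (M s t - 1))) ∣ b :=
    ⟨x, by rw [posLift_altList hst (Nat.sub_le _ _), hbx]⟩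
  obtain ⟨j, ⟨d, hd⟩, hxj, hyj, hj⟩ := H.exists_join hb (hdvd hst hbx) (hdvd hut hby)
  obtain ⟨w₀, hw₀⟩ := exists_weakLE_top M
  have hle {s : B} (hst : s ≠ t) : WeakLE M (𝐰 (altList s t (M s t - 1))) (𝐬 t * w₀) := by
    have hm := coxeterMatrix_ne_zero_of_finite M s t
    have hsym : M t s = M s t := M.symmetric t s
    have h := simple_weakLE_altList hst.symm (hsym ▸ hm)
    rw [hsym, ← simple_mul_wordProd_altList s t hm] at h
    have h' := (h.mul_left_iff (hw₀ _)).mp (hw₀ _)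
    rwa [CoxeterSystem.inv_simple] at h'
  have htj : ℓ (𝐬 t * j) = ℓ j + 1 := by
    refine (M.toCoxeterSystem.length_simple_mul j t).resolve_right fun h => ?_
    have h1 := weakLE_simple_iff.mp ((weakLE_simple_iff.mpr h).trans (hj _ (hle hst) (hle hut)))
    have h2 := weakLE_simple_iff.mp (hw₀ (𝐬 t))
    rw [CoxeterSystem.simple_mul_simple_cancel_left] at h1
    omega
  obtain ⟨hs, ha⟩ := H.eq_posLift_mul hst hb hax hbx hd hxj htj
  obtain ⟨hu, hc⟩ := H.eq_posLift_mul hut hb hcy hby hd hyj htj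
  obtain rfl | hsu := eq_or_ne s u
  · exact .inl ⟨rfl, ha.trans hc.symm⟩
  have hδ := weakLE_altList hsu hs hu
  have hsym : M u s = M s u := M.symmetric u s
  have hδ' := hδ
  rw [wordProd_altList_comm, ← hsym] at hδ'
  refine .inr ⟨hsu, posLift ((𝐰 (altList s u (M s u)))⁻¹ * (𝐬 t * j)) * d, ?_, ?_⟩
  · rw [ha, posLift_simple_mul_of_weakLE hsu hδ, mul_assoc]
  · rw [hc, posLift_simple_mul_of_weakLE (Ne.symm hsu) hδ', wordProd_altList_comm, hsym, mul_assoc]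

/-- The reduction property of the Artin-Tits monoid. -/
theorem headRel_of_mul_eq {s t : B} {a b : BraidMonoid M}
    (h : word M [s] * a = word M [t] * b) : HeadRel M s a t b := by
  suffices H : ∀ n, HeadRelBelow M n from H (size a + 1) s t a b (Nat.lt_succ_self _) h
  intro n
  induction n with
  | zero => exact fun _ _ _ _ h => absurd h (Nat.not_lt_zero _)
  | succ n H =>
  have key (l l' : List B) (h : BraidEq M l l') (hl : l.length ≤ n + 1) :
      ∀ s k t k', l = s :: k → l' = t :: k' → HeadRel M s (word M k) t (word M k') := by
    induction h with
    | refl l =>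
      rintro s k t k' rfl h
      obtain ⟨rfl, rfl⟩ := cons.inj h
      exact .inl ⟨rfl, rfl⟩
    | symm h ih => exact fun s k t k' hl' hl => (ih (h.length_eq ▸ ‹_›) t k' s k hl hl').symm
    | @trans l l' l'' h h' ih ih' =>
      rintro s k u k'' rfl rfl
      obtain ⟨t, k', rfl⟩ : ∃ t k', l' = t :: k' := by
        cases l' with
        | nil => exact absurd h.length_eq (by simp)
        | cons t k' => exact ⟨t, k', rfl⟩
      have hlen := h.length_eq
      refine H.trans ?_ (ih hl s k t k' rfl rfl) (ih' (hlen ▸ hl) t k' u k'' rfl rfl)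
      rw [size_word]
      simpa [hlen] using hl
    | @cons r l l' h _ =>
      intro s k t k' h1 h2
      obtain ⟨rfl, rfl⟩ := cons.inj h1
      obtain ⟨rfl, rfl⟩ := cons.inj h2
      exact .inl ⟨rfl, word_eq_iff.mpr h⟩
    | @braid p q l hpq hm =>
      intro s k t k' h1 h2
      obtain ⟨m, hm⟩ := Nat.exists_eq_succ_of_ne_zero hm
      rw [hm] at h1 h2
      obtain ⟨rfl, rfl⟩ := cons.inj h1
      obtain ⟨rfl, rfl⟩ := cons.inj h2
      refine .inr ⟨hpq, word M l, ?_, ?_⟩ <;> rw [hm, Nat.succ_sub_one, ← word_append] <;> rfl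
  intro s t a b hn h
  obtain ⟨a, rfl⟩ := word_surjective a
  obtain ⟨b, rfl⟩ := word_surjective b
  rw [← word_cons, ← word_cons, word_eq_iff] at h
  exact key _ _ h (by rwa [size_word] at hn) s a t b rfl rfl

end Reduction

section Garside

variable {M : CoxeterMatrix B}

local notation "ℓ" => CoxeterSystem.length (CoxeterMatrix.toCoxeterSystem M)
local notation "𝐬" => CoxeterSystem.simple (CoxeterMatrix.toCoxeterSystem M)

variable [Finite M.Group]

instance : CancelMonoid (BraidMonoid M) :=
  have hleft (a b c : BraidMonoid M) (h : a * b = a * c) : b = c := by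
    obtain ⟨l, rfl⟩ := word_surjective a
    exact HeadRelBelow.cancel_word (fun _ _ _ _ _ => headRel_of_mul_eq) le_rfl h
  { mul_left_cancel := hleft
    mul_right_cancel := fun a b c h => by
      have h' := congrArg rev h
      rw [rev_mul, rev_mul] at h'
      rw [← rev_rev b, hleft _ _ _ h', rev_rev] }

theorem exists_mul_posLift_eq (a : BraidMonoid M) (w : M.Group) :
    ∃ w' c, a * posLift w' = posLift w * c := by
  obtain ⟨l, rfl⟩ := word_surjective a
  induction l generalizing w with
  | nil => exact ⟨w, 1, by rw [word_nil, one_mul, mul_one]⟩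
  | cons s l ih =>
    obtain ⟨w₀, hw₀⟩ := exists_weakLE_top M
    obtain ⟨w', c, h⟩ := ih (𝐬 s * w₀)
    have h' := (hw₀ (𝐬 s)).posLift_eq
    rw [CoxeterSystem.inv_simple, posLift_simple] at h'
    exact ⟨w', posLift (w⁻¹ * w₀) * c, by
      rw [word_cons, mul_assoc, h, ← mul_assoc, ← h', (hw₀ w).posLift_eq, mul_assoc]⟩

theorem exists_mul_eq_mul (a b : BraidMonoid M) : ∃ c d, a * c = b * d := by
  obtain ⟨l, rfl⟩ := word_surjective b
  induction l generalizing a with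
  | nil => exact ⟨1, a, by rw [word_nil, one_mul, mul_one]⟩
  | cons s l ih =>
    obtain ⟨w, c, h⟩ := exists_mul_posLift_eq a (𝐬 s)
    obtain ⟨d, e, h'⟩ := ih c
    exact ⟨posLift w * d, e, by
      rw [word_cons, mul_assoc (word M [s]), ← h', ← mul_assoc, h, posLift_simple, mul_assoc]⟩

theorem mul_altList_dvd {z b : BraidMonoid M} {p q : B} (hpq : p ≠ q) (hp : z * word M [p] ∣ b)
    (hq : z * word M [q] ∣ b) : z * word M (altList p q (M p q)) ∣ b := by
  obtain ⟨d, hd⟩ := hp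
  obtain ⟨e, he⟩ := hq
  rw [hd, mul_assoc, mul_assoc] at he
  obtain ⟨rfl, -⟩ | ⟨-, c, rfl, -⟩ := headRel_of_mul_eq (mul_left_cancel he)
  · exact absurd rfl hpq
  · refine ⟨c, ?_⟩
    rw [hd, ← word_altList_pred q p (coxeterMatrix_ne_zero_of_finite M p q)]
    simp only [mul_assoc]

/-- Any two elements of the Artin-Tits monoid have a least common right multiple. -/
theorem exists_isJoin_dvd (x y : BraidMonoid M) : ∃ j, IsJoin (· ∣ ·) x y j := by
  obtain ⟨c, d, h⟩ := exists_mul_eq_mul x y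
  obtain ⟨j, -, hj⟩ := exists_isJoin_of_covers (X := BraidMonoid M) (· ∣ ·)
    (fun z x => ∃ s, x = z * word M [s]) (· ∣ x * c) size (size (x * c)) dvd_refl
    (fun _ _ _ => dvd_trans) (fun _ _ => dvd_trans)
    (fun z ⟨e, he⟩ => by rw [he, size_mul]; omega)
    (fun z x ⟨s, hs⟩ => ⟨⟨_, hs⟩, by rw [hs, size_mul, size_word, length_singleton]; omega⟩)
    (fun z x h => eq_or_exists_mul_word_dvd h)
    (fun z x y ⟨p, hp⟩ ⟨q, hq⟩ hx hy => by
      subst hp hq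
      obtain rfl | hpq := eq_or_ne p q
      · exact ⟨_, hx, dvd_rfl, dvd_rfl, fun w h _ => h⟩
      have hm := coxeterMatrix_ne_zero_of_finite M p q
      refine ⟨_, mul_altList_dvd hpq hx hy, ?_, ?_, fun w => mul_altList_dvd hpq⟩
      · rw [← word_altList_pred q p hm]
        exact mul_dvd_mul_left z (dvd_mul_right _ _)
      · rw [word_altList_comm hpq hm, ← word_altList_pred p q hm]
        exact mul_dvd_mul_left z (dvd_mul_right _ _))
    1 x y (one_dvd x) (one_dvd y) ⟨c, rfl⟩ ⟨d, h⟩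
  exact ⟨j, hj⟩

/-- Any two elements of the Artin-Tits monoid have a least common left multiple. -/
theorem exists_least_left_mul (x y : BraidMonoid M) :
    ∃ c d, c * x = d * y ∧ ∀ c' d', c' * x = d' * y → ∃ e, c' = e * c := by
  obtain ⟨j, ⟨c, hc⟩, ⟨d, hd⟩, hj⟩ := exists_isJoin_dvd (rev x) (rev y)
  have hx : rev c * x = rev j := by rw [hc, rev_mul, rev_rev]
  have hy : rev d * y = rev j := by rw [hd, rev_mul, rev_rev]
  refine ⟨rev c, rev d, hx.trans hy.symm, fun c' d' h => ?_⟩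
  obtain ⟨e, he⟩ := hj (rev (c' * x)) ⟨rev c', rev_mul _ _⟩ ⟨rev d', by rw [h, rev_mul]⟩
  refine ⟨rev e, mul_right_cancel (b := x) ?_⟩
  rw [mul_assoc, hx, ← rev_mul, ← he, rev_rev]

end Garside

section Embedding

open OreLocalization

/-- Ore's theorem: a cancellative monoid in which any two elements have a common left multiple
embeds into a group. -/
theorem exists_injective_hom_group.{u} {N : Type u} [CancelMonoid N]
    (h : ∀ a b : N, ∃ c d, c * a = d * b) :
    ∃ (G : Type u) (_ : Group G) (φ : N →* G), Function.Injective φ := by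
  choose num den hnd using h
  let _ : OreSet (⊤ : Submonoid N) :=
    { ore_right_cancel := fun r₁ r₂ s h => ⟨1, by rw [mul_right_cancel h]⟩
      oreNum := fun r s => den r s
      oreDenom := fun r s => ⟨num r s, trivial⟩
      ore_eq := fun r s => hnd r s }
  refine ⟨(OreLocalization (⊤ : Submonoid N) N)ˣ, inferInstance,
    IsUnit.liftRight numeratorHom fun a => numerator_isUnit (⟨a, trivial⟩ : (⊤ : Submonoid N)), ?_⟩
  intro a b hab
  have hab' := congrArg Units.val hab
  rw [IsUnit.coe_liftRight, IsUnit.coe_liftRight, numeratorHom_apply, numeratorHom_apply,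
    oreDiv_eq_iff] at hab'
  obtain ⟨u, v, h1, h2⟩ := hab'
  rw [Submonoid.coe_one, mul_one, mul_one] at h2
  rw [Submonoid.smul_def, h2, smul_eq_mul, smul_eq_mul] at h1
  exact (mul_left_cancel h1).symm

variable {M : CoxeterMatrix B}

theorem lift_listProd {G : Type*} [Group G] (f : B → G) (l : List B) :
    FreeGroup.lift f ((l.map FreeGroup.of).prod) = (l.map f).prod := by
  rw [map_list_prod, List.map_map]
  simp [Function.comp_def]

theorem prod_map_gen (l : List B) :
    (l.map (gen M)).prod = PresentedGroup.mk (braidRels M) ((l.map FreeGroup.of).prod) := by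
  rw [map_list_prod, List.map_map]
  rfl

variable (M) in
/-- The canonical map from the Artin-Tits monoid to the Artin-Tits group. -/
def toArtin : BraidMonoid M →* Artin M :=
  braidLift (gen M) fun s t hst hm => by
    rw [prod_map_gen, prod_map_gen]
    exact PresentedGroup.mk_eq_mk_of_mul_inv_mem ⟨s, t, hst, hm, rfl⟩

theorem toArtin_word (l : List B) : toArtin M (word M l) = (l.map (gen M)).prod :=
  braidLift_word _ _ l

theorem toArtin_mem_posMon (a : BraidMonoid M) : toArtin M a ∈ posMon M := by
  obtain ⟨l, rfl⟩ := word_surjective a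
  rw [toArtin_word]
  refine Submonoid.list_prod_mem _ fun x hx => ?_
  obtain ⟨s, -, rfl⟩ := mem_map.mp hx
  exact Submonoid.subset_closure ⟨s, rfl⟩

theorem exists_toArtin_eq {g : Artin M} (hg : g ∈ posMon M) : ∃ a, toArtin M a = g := by
  have hle : posMon M ≤ MonoidHom.mrange (toArtin M) := by
    rw [posMon, Submonoid.closure_le]
    rintro _ ⟨s, rfl⟩
    exact ⟨word M [s], by simp [toArtin_word]⟩
  exact hle hg

theorem toArtin_injective [Finite M.Group] : Function.Injective (toArtin M) := by
  obtain ⟨G, _, φ, hφ⟩ := exists_injective_hom_group (N := BraidMonoid M) fun a b => by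
    obtain ⟨c, d, h, -⟩ := exists_least_left_mul a b
    exact ⟨c, d, h⟩
  have hφw (l : List B) : (l.map fun s => φ (word M [s])).prod = φ (word M l) := by
    induction l with
    | nil => rw [word_nil, map_one]; rfl
    | cons s l ih => rw [map_cons, prod_cons, ih, ← map_mul, ← word_cons]
  have hrel : ∀ r ∈ braidRels M, FreeGroup.lift (fun s => φ (word M [s])) r = 1 := by
    rintro r ⟨s, t, hst, hm, rfl⟩
    rw [map_mul, map_inv, lift_listProd, lift_listProd, hφw, hφw, word_altList_comm hst hm,
      mul_inv_cancel]
  have key (a : BraidMonoid M) : PresentedGroup.toGroup hrel (toArtin M a) = φ a := by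
    obtain ⟨l, rfl⟩ := word_surjective a
    rw [← hφw, ← lift_listProd, toArtin_word, prod_map_gen]
    rfl
  intro a b hab
  apply hφ
  rw [← key, ← key, hab]

end Embedding

theorem exists_eq_word_singleton {M : CoxeterMatrix B} {a : BraidMonoid M} (h : size a = 1) :
    ∃ u, a = word M [u] := by
  obtain ⟨l, rfl⟩ := word_surjective a
  obtain ⟨u, rfl⟩ := length_eq_one_iff.mp (by rwa [size_word] at h)
  exact ⟨u, rfl⟩

theorem toArtin_singleton {M : CoxeterMatrix B} (s : B) : toArtin M (word M [s]) = gen M s := by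
  rw [toArtin_word, map_singleton, prod_singleton]

/-- If `g₁` and `g₂` have no common right divisor and conjugate the atoms `s` and `t` to the same
element of the Artin-Tits group, then this element is an atom. -/
theorem exists_atom_of_conj_eq {M : CoxeterMatrix B} [Finite M.Group] {s t : B}
    {a b : BraidMonoid M} (hgcd : ∀ c d e, d * c = a → e * c = b → c = 1)
    (h : (toArtin M b)⁻¹ * gen M t * toArtin M b = (toArtin M a)⁻¹ * gen M s * toArtin M a) :
    ∃ u, word M [t] * b = b * word M [u] ∧ word M [s] * a = a * word M [u] := by
  obtain ⟨x, y, hxy⟩ := exists_mul_eq_mul a (word M [s] * a)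
  have hxy' : b * x = word M [t] * b * y := by
    apply toArtin_injective
    have h1 := congrArg (toArtin M) hxy
    simp only [map_mul, toArtin_singleton] at h1 ⊢
    have h2 : toArtin M x = (toArtin M a)⁻¹ * gen M s * toArtin M a * toArtin M y := by
      rw [mul_assoc, mul_assoc, ← mul_assoc (gen M s), ← h1, inv_mul_cancel_left]
    rw [h2, ← h]
    simp only [mul_assoc, mul_inv_cancel_left]
  obtain ⟨c, d, hcd, hmin⟩ := exists_least_left_mul x y
  obtain ⟨e, he⟩ := hmin _ _ hxy
  obtain ⟨f, hf⟩ := hmin _ _ hxy'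
  obtain rfl := hgcd c e f he.symm hf.symm
  rw [one_mul] at hcd
  subst hcd
  rw [← mul_assoc] at hxy hxy'
  have ha := mul_right_cancel hxy
  have hb := mul_right_cancel hxy'
  obtain ⟨u, rfl⟩ := exists_eq_word_singleton (a := d) (by
    have := congrArg size ha
    rw [size_mul, size_mul, size_word, length_singleton] at this
    omega)
  exact ⟨u, hb.symm, ha.symm⟩

/-- **Lemma (Godelle).** In a spherical-type Artin-Tits system, if `g = g₁g₂⁻¹` is the right
normal form of `g` and `s, t ∈ S`, then `gt = sg` iff `tg₂ = g₂u` and `sg₁ = g₁u` for some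
`u ∈ S`. -/
theorem normal_form_conj_iff
    [Finite B] (M : CoxeterMatrix B) (hsph : Finite M.Group) (s t : B)
    (g g₁ g₂ : Artin M) (h1 : g₁ ∈ posMon M) (h2 : g₂ ∈ posMon M)
    (hg : g = g₁ * g₂⁻¹)
    (hgcd : ∀ c ∈ posMon M, rdvd M c g₁ → rdvd M c g₂ → c = 1) :
    g * gen M t = gen M s * g ↔
      ∃ u : B, gen M t * g₂ = g₂ * gen M u ∧ gen M s * g₁ = g₁ * gen M u := by
  subst hg
  constructor
  · intro h
    obtain ⟨a, rfl⟩ := exists_toArtin_eq h1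
    obtain ⟨b, rfl⟩ := exists_toArtin_eq h2
    obtain ⟨u, hb, ha⟩ := exists_atom_of_conj_eq (s := s) (t := t) (a := a) (b := b)
      (fun c d e hd he => toArtin_injective (by
        rw [map_one]
        exact hgcd _ (toArtin_mem_posMon c) ⟨_, toArtin_mem_posMon d, by rw [← map_mul, hd]⟩
          ⟨_, toArtin_mem_posMon e, by rw [← map_mul, he]⟩))
      (by
        rw [mul_assoc _ (gen M s), eq_inv_mul_iff_mul_eq, ← mul_assoc, ← mul_assoc, h, mul_assoc,
          inv_mul_cancel_right])
    exact ⟨u, by simpa only [map_mul, toArtin_singleton] using congrArg (toArtin M) hb,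
      by simpa only [map_mul, toArtin_singleton] using congrArg (toArtin M) ha⟩
  · rintro ⟨u, hu2, hu1⟩
    rw [← mul_assoc, hu1, mul_assoc, mul_assoc, mul_right_inj, inv_mul_eq_iff_eq_mul, ← mul_assoc,
      ← hu2, mul_inv_cancel_right]

end ArtinTitsPaper
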